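/- arXiv:2409.16279 — 2 statements merged into one kernel-verified Lean document; each statement's English description precedes it below -/
import Mathlib

section
/- Let G be a finite connected graph with a fixed 1-planar drawing, and consider a position in the game of Cops and Robbers on G. If two consecutive endpoints of a crossing of G are guarded, then the crossing point (dummy vertex) of that crossing is guarded. -/
/-!
Common definitions: the game of Cops and Robbers (strategies, plays, capture,
cop number), 1-planar drawings in the plane, crossings, ×-crossings, kite
edges, guarding of vertices and crossing points, subgraphs of the
planarization, cop territory, robber territory, and the edge sets `S_H(v)`.
-/

namespace CopsRobbersOnePlanar

/-- `f` parametrizes a simple (injective) arc from `p` to `q` over `[0,1]`. -/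
structure IsArc (f : ℝ → ℝ × ℝ) (p q : ℝ × ℝ) : Prop where
  continuousOn : ContinuousOn f (Set.Icc 0 1)
  injOn : Set.InjOn f (Set.Icc 0 1)
  source : f 0 = p
  target : f 1 = q

/-- A 1-planar drawing of a simple graph `G` in the plane: vertices are mapped to
distinct points, each edge to a simple arc joining its endpoints whose interior
avoids all vertices; arcs of distinct edges meet only at shared endpoints or at
interior points; each edge has at most one interior intersection point with the
other arcs (each edge is crossed at most once); arcs of edges sharing an
endpoint do not cross; and no three arcs pass through a common interior point. -/
structure OnePlanarDrawing {V : Type} (G : SimpleGraph V) where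
  vpos : V → ℝ × ℝ
  vpos_inj : Function.Injective vpos
  arc : Sym2 V → ℝ → ℝ × ℝ
  arc_spec : ∀ u v : V, G.Adj u v →
    IsArc (arc s(u, v)) (vpos u) (vpos v) ∨ IsArc (arc s(u, v)) (vpos v) (vpos u)
  arc_avoids_vertices : ∀ e ∈ G.edgeSet, ∀ w : V,
    vpos w ∉ arc e '' Set.Ioo (0 : ℝ) 1
  arcs_meet_properly : ∀ e ∈ G.edgeSet, ∀ f ∈ G.edgeSet, e ≠ f →
    ∀ p ∈ (arc e '' Set.Icc (0 : ℝ) 1) ∩ (arc f '' Set.Icc (0 : ℝ) 1),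
      (∃ w : V, w ∈ e ∧ w ∈ f ∧ p = vpos w) ∨
        p ∈ (arc e '' Set.Ioo (0 : ℝ) 1) ∩ (arc f '' Set.Ioo (0 : ℝ) 1)
  crossed_at_most_once : ∀ e ∈ G.edgeSet,
    Set.Subsingleton {p : ℝ × ℝ | ∃ f ∈ G.edgeSet, f ≠ e ∧
      p ∈ (arc e '' Set.Ioo (0 : ℝ) 1) ∩ (arc f '' Set.Ioo (0 : ℝ) 1)}
  no_adjacent_crossing : ∀ e ∈ G.edgeSet, ∀ f ∈ G.edgeSet, e ≠ f →
    (∃ w : V, w ∈ e ∧ w ∈ f) →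
    (arc e '' Set.Ioo (0 : ℝ) 1) ∩ (arc f '' Set.Ioo (0 : ℝ) 1) = ∅
  no_triple_point : ∀ e ∈ G.edgeSet, ∀ f ∈ G.edgeSet, ∀ g ∈ G.edgeSet,
    e ≠ f → e ≠ g → f ≠ g →
    (arc e '' Set.Ioo (0 : ℝ) 1) ∩ (arc f '' Set.Ioo (0 : ℝ) 1) ∩
      (arc g '' Set.Ioo (0 : ℝ) 1) = ∅

variable {V : Type}

/-- Two edges cross in the drawing `D`: their arcs share an interior point. -/
def OnePlanarDrawing.Crosses {G : SimpleGraph V} (D : OnePlanarDrawing G)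
    (e f : Sym2 V) : Prop :=
  e ∈ G.edgeSet ∧ f ∈ G.edgeSet ∧ e ≠ f ∧
    ((D.arc e '' Set.Ioo (0 : ℝ) 1) ∩ (D.arc f '' Set.Ioo (0 : ℝ) 1)).Nonempty

/-- An edge is uncrossed in the drawing `D`. -/
def OnePlanarDrawing.Uncrossed {G : SimpleGraph V} (D : OnePlanarDrawing G)
    (e : Sym2 V) : Prop :=
  ∀ f, ¬ D.Crosses e f

/-- An ×-crossing: a crossing such that `G` contains no edge joining any two
consecutive endpoints (i.e. endpoints of the two different crossing edges). -/
def OnePlanarDrawing.IsXCrossing {G : SimpleGraph V} (D : OnePlanarDrawing G)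
    (e f : Sym2 V) : Prop :=
  D.Crosses e f ∧ ∀ u w : V, u ∈ e → w ∈ f → ¬ G.Adj u w

/-- The drawing has a kite edge at every crossing: an uncrossed edge of `G`
joining two consecutive endpoints of the crossing. -/
def OnePlanarDrawing.HasKites {G : SimpleGraph V} (D : OnePlanarDrawing G) : Prop :=
  ∀ e f, D.Crosses e f →
    ∃ u w : V, u ∈ e ∧ w ∈ f ∧ G.Adj u w ∧ D.Uncrossed s(u, w)

/-- A strategy for `k` cops on `G`: an initial placement, and a move function
(depending on the current cop positions and the robber's position) under which
every cop either stays put or moves to an adjacent vertex. -/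
structure CopStrategy (G : SimpleGraph V) (k : ℕ) where
  init : Fin k → V
  move : (Fin k → V) → V → Fin k → V
  move_valid : ∀ c r i, move c r i = c i ∨ G.Adj (c i) (move c r i)

/-- A play of the game with `k` cops on `G`: `cop n` is the cop configuration
after the cops' turn of round `n`, and `rob n` is the robber's vertex after the
robber's turn of round `n` (round `0` being the initial placements, cops first).
In each turn every player either stays or moves to an adjacent vertex. -/
structure GamePlay (G : SimpleGraph V) (k : ℕ) where
  cop : ℕ → Fin k → V
  rob : ℕ → V
  cop_valid : ∀ n i, cop (n + 1) i = cop n i ∨ G.Adj (cop n i) (cop (n + 1) i)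
  rob_valid : ∀ n, rob (n + 1) = rob n ∨ G.Adj (rob n) (rob (n + 1))

/-- The cops in the play `π` follow the strategy `cs`. -/
def GamePlay.Follows {G : SimpleGraph V} {k : ℕ} (π : GamePlay G k)
    (cs : CopStrategy G k) : Prop :=
  π.cop 0 = cs.init ∧ ∀ n, π.cop (n + 1) = cs.move (π.cop n) (π.rob n)

/-- The robber is captured at round `n`: some cop occupies the robber's vertex,
either when the robber lands on it, or when the cops move in the next round. -/
def GamePlay.CapturedAt {G : SimpleGraph V} {k : ℕ} (π : GamePlay G k) (n : ℕ) : Prop :=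
  ∃ i, π.cop n i = π.rob n ∨ π.cop (n + 1) i = π.rob n

/-- `k` cops have a winning strategy on `G`. -/
def CopsWin (G : SimpleGraph V) (k : ℕ) : Prop :=
  ∃ cs : CopStrategy G k, ∀ π : GamePlay G k, π.Follows cs → ∃ n, π.CapturedAt n

/-- The cop number of `G`: the least number of cops that can win on `G`. -/
noncomputable def copNumber (G : SimpleGraph V) : ℕ :=
  sInf {k | CopsWin G k}

/-- From time `N` on, the designated cop `i0` guards the vertex `v` in the play
`π`: whenever the robber is on `v`, either he was already captured earlier, or
cop `i0` occupies `v` now or at the next cops' turn (immediate capture). -/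
def GamePlay.GuardsVertexBy {G : SimpleGraph V} {k : ℕ} (π : GamePlay G k)
    (i0 : Fin k) (N : ℕ) (v : V) : Prop :=
  ∀ n, N ≤ n → π.rob n = v →
    (∃ m < n, π.CapturedAt m) ∨ π.cop n i0 = v ∨ π.cop (n + 1) i0 = v

/-- From time `N` on, the cops guard the vertex `v` in the play `π`: the robber
cannot land on `v` (he is captured before) or is captured immediately after
landing on `v`. -/
def GamePlay.GuardsVertex {G : SimpleGraph V} {k : ℕ} (π : GamePlay G k)
    (N : ℕ) (v : V) : Prop :=
  ∀ n, N ≤ n → π.rob n = v →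
    (∃ m < n, π.CapturedAt m) ∨ ∃ i, π.cop n i = v ∨ π.cop (n + 1) i = v

/-- From time `N` on, the cops prevent the robber from traversing the edge `e`
(from one endpoint to the opposite endpoint): the robber was captured before
completing such a move, or is captured immediately after making it.  Guarding a
crossing point means preventing traversal of both edges of the crossing. -/
def GamePlay.GuardsTraversal {G : SimpleGraph V} {k : ℕ} (π : GamePlay G k)
    (N : ℕ) (e : Sym2 V) : Prop :=
  ∀ n, N ≤ n → ∀ u w : V, e = s(u, w) → π.rob n = u → π.rob (n + 1) = w →
    (∃ m < n + 1, π.CapturedAt m) ∨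
      ∃ i, π.cop (n + 1) i = w ∨ π.cop (n + 2) i = w

/-- As `GamePlay.GuardsTraversal`, but the capturing cop right after the
traversal is required to come from the index set `I`. -/
def GamePlay.GuardsTraversalOn {G : SimpleGraph V} {k : ℕ} (π : GamePlay G k)
    (I : Set (Fin k)) (N : ℕ) (e : Sym2 V) : Prop :=
  ∀ n, N ≤ n → ∀ u w : V, e = s(u, w) → π.rob n = u → π.rob (n + 1) = w →
    (∃ m < n + 1, π.CapturedAt m) ∨
      ∃ i ∈ I, π.cop (n + 1) i = w ∨ π.cop (n + 2) i = w

/-- A subgraph `H` of the planarization `G×`, recorded by its vertex set: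
`gverts` is its set of `G`-vertices, and `dummies` is the set of crossed edges
of `G` whose crossing point (dummy vertex) belongs to `H`; the latter is closed
under crossing partners since both edges of a crossing carry the same dummy
vertex. -/
structure PlanSubgraph (G : SimpleGraph V) (D : OnePlanarDrawing G) where
  gverts : Set V
  dummies : Set (Sym2 V)
  dummies_crossed : ∀ e ∈ dummies, ∃ f, D.Crosses e f
  dummies_closed : ∀ e ∈ dummies, ∀ f, D.Crosses e f → f ∈ dummies

/-- The subgraph `H` of `G×` is guarded from time `N` on in the play `π`: all
its `G`-vertices are guarded and all its dummy vertices (crossing points) are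
guarded. -/
def GuardedSubgraph {G : SimpleGraph V} {D : OnePlanarDrawing G} {k : ℕ}
    (π : GamePlay G k) (N : ℕ) (H : PlanSubgraph G D) : Prop :=
  (∀ v ∈ H.gverts, π.GuardsVertex N v) ∧
    (∀ e ∈ H.dummies, π.GuardsTraversal N e)

/-- The edge set of the cop territory `C(H)`: edges `e` of `G` with
`e× ∩ H ≠ ∅`, i.e. an endpoint of `e` is a `G`-vertex of `H`, or the crossing
point of `e` is a dummy vertex of `H`. -/
def copTerritoryEdges {G : SimpleGraph V} {D : OnePlanarDrawing G}
    (H : PlanSubgraph G D) : Set (Sym2 V) :=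
  {e | e ∈ G.edgeSet ∧ ((∃ v ∈ e, v ∈ H.gverts) ∨ e ∈ H.dummies)}

/-- The vertex set of the robber territory `R(H)`: the connected component of
`G` minus the edges of the cop territory that contains the robber's current
vertex `r`. -/
def robberTerritory {G : SimpleGraph V} {D : OnePlanarDrawing G}
    (H : PlanSubgraph G D) (r : V) : Set V :=
  {w | (G.deleteEdges (copTerritoryEdges H)).Reachable r w}

/-- The edge set of the robber territory `R(H)`. -/
def robberTerritoryEdges {G : SimpleGraph V} {D : OnePlanarDrawing G}
    (H : PlanSubgraph G D) (r : V) : Set (Sym2 V) :=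
  {e | e ∈ (G.deleteEdges (copTerritoryEdges H)).edgeSet ∧
    ∀ v ∈ e, v ∈ robberTerritory H r}

/-- `S_H(v)` for a `G`-vertex `v` of `H` (with the robber at `r`): the edges
`e` of `G` joining `v` to a vertex of the robber territory `R(H)` such that
`e× ∩ H = {v}`. -/
def SH {G : SimpleGraph V} {D : OnePlanarDrawing G}
    (H : PlanSubgraph G D) (r v : V) : Set (Sym2 V) :=
  {e | ∃ w : V, e = s(v, w) ∧ G.Adj v w ∧ w ∈ robberTerritory H r ∧
    w ∉ H.gverts ∧ e ∉ H.dummies}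

end CopsRobbersOnePlanar

namespace CopsRobbersOnePlanar

/-- Guarding one endpoint of an edge prevents its traversal in either direction. -/
theorem GamePlay.GuardsVertex.guardsTraversal {V : Type} {G : SimpleGraph V} {k : ℕ}
    {π : GamePlay G k} {N : ℕ} {v : V} (h : π.GuardsVertex N v) {e : Sym2 V} (hv : v ∈ e) :
    π.GuardsTraversal N e := by
  intro n hn a b hab ha hb
  rw [hab, Sym2.mem_iff] at hv
  rcases hv with rfl | rfl
  · left
    rcases h n hn ha with ⟨m, hm, hc⟩ | ⟨i, hi⟩
    · exact ⟨m, hm.trans n.lt_succ_self, hc⟩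
    · exact ⟨n, n.lt_succ_self, i, by rwa [ha]⟩
  · exact h (n + 1) (hn.trans n.le_succ) hb

/-- Observation 1. In any play on a finite connected graph
with a fixed 1-planar drawing, if two consecutive endpoints of a crossing are
guarded (from time `N` on), then the crossing point of that crossing is guarded
(the robber cannot move between opposite endpoints of the crossing without
being captured). -/
theorem crossing_point_guarded_of_consecutive_endpoints_guarded
    {V : Type} [Fintype V] (G : SimpleGraph V) (hconn : G.Connected)
    (D : OnePlanarDrawing G) {k : ℕ} (π : GamePlay G k) (N : ℕ)
    (e f : Sym2 V) (hcross : D.Crosses e f)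
    (u w : V) (hu : u ∈ e) (hw : w ∈ f)
    (hgu : π.GuardsVertex N u) (hgw : π.GuardsVertex N w) :
    π.GuardsTraversal N e ∧ π.GuardsTraversal N f :=
  ⟨hgu.guardsTraversal hu, hgw.guardsTraversal hw⟩

end CopsRobbersOnePlanar
end

section
/- Let G be a finite connected graph with a fixed 1-planar drawing having no ×-crossings and with a kite edge at every crossing, let H be a guarded subgraph of G×, and let a and b be two distinct G-vertices of H each having a neighbour in the robber territory R := R(H). Let I := R ∪ S_H(a) ∪ S_H(b), with its drawing inherited from G. Then every crossing of I that is an ×-crossing of I has both a and b among its endpoints, and moreover a and b are consecutive (not opposite) endpoints of any such crossing. -/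
namespace CopsRobbersOnePlanar

/-- If the robber territory contains a vertex outside `H`, it avoids `H` altogether. -/
theorem notMem_gverts_of_mem_robberTerritory {G : SimpleGraph V} {D : OnePlanarDrawing G}
    {H : PlanSubgraph G D} {r x w : V} (hx : x ∈ robberTerritory H r) (hxH : x ∉ H.gverts)
    (hw : w ∈ robberTerritory H r) : w ∉ H.gverts := by
  intro hwH
  have hwx : (G.deleteEdges (copTerritoryEdges H)).Reachable w x := hw.symm.trans hx
  obtain ⟨p⟩ := hwx
  cases p with
  | nil => exact hxH hwH
  | cons h _ =>
    rw [SimpleGraph.deleteEdges_adj] at h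
    exact h.2 ⟨h.1, Or.inl ⟨w, Sym2.mem_mk_left _ _, hwH⟩⟩

/-- An uncrossed edge carries no dummy vertex of `H`. -/
theorem OnePlanarDrawing.Uncrossed.notMem_dummies {G : SimpleGraph V} {D : OnePlanarDrawing G}
    {e : Sym2 V} (he : D.Uncrossed e) (H : PlanSubgraph G D) : e ∉ H.dummies := fun h =>
  let ⟨f, hf⟩ := H.dummies_crossed e h
  he f hf

/-- An edge of `G` inside the robber territory that misses `H` is an edge of the
robber territory. -/
theorem mem_robberTerritoryEdges {G : SimpleGraph V} {D : OnePlanarDrawing G}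
    {H : PlanSubgraph G D} {r u w : V} (huw : G.Adj u w)
    (hu : u ∈ robberTerritory H r) (hw : w ∈ robberTerritory H r)
    (huH : u ∉ H.gverts) (hwH : w ∉ H.gverts) (hd : s(u, w) ∉ H.dummies) :
    s(u, w) ∈ robberTerritoryEdges H r := by
  refine ⟨?_, ?_⟩
  · rw [SimpleGraph.mem_edgeSet, SimpleGraph.deleteEdges_adj]
    refine ⟨huw, ?_⟩
    rintro ⟨-, ⟨v, hv, hvH⟩ | h⟩
    · rcases Sym2.mem_iff.1 hv with rfl | rfl
      exacts [huH hvH, hwH hvH]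
    · exact hd h
  · intro v hv
    rcases Sym2.mem_iff.1 hv with rfl | rfl
    exacts [hu, hw]

/-- Every endpoint of an edge of `R(H) ∪ S_H(a) ∪ S_H(b)` is `a`, `b`, or in `R(H)`. -/
theorem eq_or_mem_robberTerritory_of_mem {G : SimpleGraph V} {D : OnePlanarDrawing G}
    {H : PlanSubgraph G D} {r a b u : V} {e : Sym2 V}
    (he : e ∈ robberTerritoryEdges H r ∪ SH H r a ∪ SH H r b) (hu : u ∈ e) :
    u = a ∨ u = b ∨ u ∈ robberTerritory H r := by
  rcases he with (he | ⟨w, rfl, -, hw, -⟩) | ⟨w, rfl, -, hw, -⟩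
  · exact Or.inr (Or.inr (he.2 u hu))
  · rcases Sym2.mem_iff.1 hu with rfl | rfl <;> simp [hw]
  · rcases Sym2.mem_iff.1 hu with rfl | rfl <;> simp [hw]

/-- Let `G` be a finite connected graph with a fixed 1-planar
drawing having no ×-crossings and a kite edge at every crossing, let `H` be a
subgraph of `G×` guarded (from time `N` on) in a play `π`, and let `a, b` be
two distinct `G`-vertices of `H` each having a neighbour in the robber
territory `R := R(H)` (taken at the robber's current vertex `π.rob n`,
`n ≥ N`).  Let `I := R ∪ S_H(a) ∪ S_H(b)`, with its drawing inherited from `G`.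
Then every crossing of `I` that is an ×-crossing of `I` (no edge of `I` joins
two consecutive endpoints) has both `a` and `b` among its endpoints, and `a`
and `b` are consecutive (they lie on different edges of the crossing). -/
theorem xcrossings_of_I_have_a_b_consecutive
    {V : Type} [Fintype V] (G : SimpleGraph V) (hconn : G.Connected)
    (D : OnePlanarDrawing G)
    (hnoX : ∀ e f : Sym2 V, ¬ D.IsXCrossing e f) (hkite : D.HasKites)
    {k : ℕ} (π : GamePlay G k) (N : ℕ) (H : PlanSubgraph G D)
    (hguard : GuardedSubgraph π N H) (n : ℕ) (hn : N ≤ n)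
    (a b : V) (ha : a ∈ H.gverts) (hb : b ∈ H.gverts) (hab : a ≠ b)
    (hSa : (SH H (π.rob n) a).Nonempty) (hSb : (SH H (π.rob n) b).Nonempty) :
    ∀ e f : Sym2 V, D.Crosses e f →
      e ∈ robberTerritoryEdges H (π.rob n) ∪ SH H (π.rob n) a ∪ SH H (π.rob n) b →
      f ∈ robberTerritoryEdges H (π.rob n) ∪ SH H (π.rob n) a ∪ SH H (π.rob n) b →
      (∀ u w : V, u ∈ e → w ∈ f →
        s(u, w) ∉ robberTerritoryEdges H (π.rob n) ∪ SH H (π.rob n) a ∪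
          SH H (π.rob n) b) →
      ((a ∈ e ∧ b ∈ f) ∨ (b ∈ e ∧ a ∈ f)) := by
  intro e f hef he hf hX
  obtain ⟨u, w, hu, hw, huw, hun⟩ := hkite e f hef
  have hd : s(u, w) ∉ H.dummies := hun.notMem_dummies H
  have hR : ∀ v ∈ robberTerritory H (π.rob n), v ∉ H.gverts := by
    obtain ⟨_, x, -, -, hx, hxH, -⟩ := hSa
    exact fun v hv => notMem_gverts_of_mem_robberTerritory hx hxH hv
  have hI := hX u w hu hw
  rcases eq_or_mem_robberTerritory_of_mem he hu with rfl | rfl | huR <;>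
    rcases eq_or_mem_robberTerritory_of_mem hf hw with rfl | rfl | hwR
  · exact absurd huw (SimpleGraph.irrefl G)
  · exact Or.inl ⟨hu, hw⟩
  · exact absurd (Or.inl (Or.inr ⟨w, rfl, huw, hwR, hR w hwR, hd⟩)) hI
  · exact Or.inr ⟨hu, hw⟩
  · exact absurd huw (SimpleGraph.irrefl G)
  · exact absurd (Or.inr ⟨w, rfl, huw, hwR, hR w hwR, hd⟩) hI
  · exact absurd (Or.inl (Or.inr ⟨u, Sym2.eq_swap, huw.symm, huR, hR u huR, hd⟩)) hI
  · exact absurd (Or.inr ⟨u, Sym2.eq_swap, huw.symm, huR, hR u huR, hd⟩) hI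
  · exact absurd (Or.inl (Or.inl
      (mem_robberTerritoryEdges huw huR hwR (hR u huR) (hR w hwR) hd))) hI

end CopsRobbersOnePlanar
end
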